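/- Let p be a prime, K a field of characteristic p, and m ≥ 2. For every a ∈ K and b ∈ K^×, the element V( ([a]^p − [a])·[b⁻¹] ) · d( V([b]) ) of Ω¹(W_m(K)) belongs to M'_m. (This is the key step showing that the images of the subgroups N_n and N'_n agree in the direct limit: applying V⊗V to the extra generator ℘([a])·[b]⁻¹ ⊗ [b] of N_n lands in N'_{n+1}.) -/

import Mathlib

noncomputable section

namespace TruncatedWittVector

variable {p n : ℕ} [hp : Fact p.Prime] {R : Type*} [CommRing R]

/-- Verschiebung on truncated Witt vectors: `(x₀,…,x_{n-1}) ↦ (0,x₀,…,x_{n-2})`. -/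
def vers (x : TruncatedWittVector p n R) : TruncatedWittVector p n R :=
  WittVector.truncate n (WittVector.verschiebung x.out)

/-- Frobenius on truncated Witt vectors (in characteristic `p` it raises each
coefficient to the `p`-th power). -/
def frob (x : TruncatedWittVector p n R) : TruncatedWittVector p n R :=
  WittVector.truncate n (WittVector.frobenius x.out)

/-- Teichmüller representative `[a] = (a,0,…,0)` in truncated Witt vectors. -/
def teich (a : R) : TruncatedWittVector p n R :=
  WittVector.truncate n (WittVector.teichmuller p a)

end TruncatedWittVector

namespace TruncatedWittVector

variable {p n : ℕ} [Fact p.Prime] {R : Type*} [CommRing R]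

theorem frob_truncate [CharP R p] (x : WittVector p R) :
    frob (WittVector.truncate n x) = WittVector.truncate n (WittVector.frobenius x) := by
  ext i
  simp only [frob, WittVector.coeff_truncate, WittVector.coeff_frobenius_charP, coeff_out]

theorem frob_vers [CharP R p] (x : TruncatedWittVector p n R) :
    frob (vers x) = p * x := by
  rw [vers, frob_truncate, WittVector.frobenius_verschiebung, map_mul, map_natCast, mul_comm]
  congr 1
  exact truncateFun_out x

theorem teich_mul (a b : R) :
    (teich (a * b) : TruncatedWittVector p n R) = teich a * teich b := by
  simp only [teich, map_mul]

theorem teich_pow (a : R) (k : ℕ) :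
    (teich (a ^ k) : TruncatedWittVector p n R) = teich a ^ k := by
  simp only [teich, map_pow]

theorem teich_one : (teich 1 : TruncatedWittVector p n R) = 1 := by
  simp only [teich, map_one]

theorem frob_teich [CharP R p] (a : R) :
    frob (teich a : TruncatedWittVector p n R) = teich a ^ p := by
  rw [← teich_pow, teich, teich, frob_truncate]
  ext i
  simp only [WittVector.coeff_truncate, WittVector.coeff_frobenius_charP]
  rcases Nat.eq_zero_or_pos (i : ℕ) with h | h
  · simp only [h, WittVector.teichmuller_coeff_zero]
  · simp only [WittVector.teichmuller_coeff_pos _ _ _ h, zero_pow (Fact.out : p.Prime).ne_zero]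

theorem vers_frob [CharP R p] (x : TruncatedWittVector p n R) :
    vers (frob x) = p * x := by
  obtain ⟨x, rfl⟩ := WittVector.truncate_surjective p n R x
  rw [← map_natCast (WittVector.truncate n), ← map_mul, mul_comm,
    ← WittVector.verschiebung_frobenius, frob_truncate]
  ext i
  simp only [vers, WittVector.coeff_truncate]
  obtain ⟨_ | i, hi⟩ := i
  · simp only [WittVector.verschiebung_coeff_zero]
  · simpa only [WittVector.verschiebung_coeff_succ, WittVector.coeff_truncate] using
      coeff_out (WittVector.truncate n (WittVector.frobenius x)) ⟨i, by omega⟩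

end TruncatedWittVector

open TruncatedWittVector in
/-- For `m ≥ 2`, `a ∈ K` and `b ∈ K^×`, the element
`V(([a]^p − [a])·[b⁻¹])·d(V([b]))` of `Ω¹(W_m(K))` belongs to `M'_m`, the additive
subgroup generated by the elements `F(x)·d(y) − x·d(V(y))` for `x, y ∈ W_m(K)`. -/
theorem V_wp_teich_dlog_V_teich_mem_M'
    (p : ℕ) [Fact p.Prime] (K : Type*) [Field K] [CharP K p] (m : ℕ) (hm : 2 ≤ m)
    (a b : K) (hb : b ≠ 0) :
    TruncatedWittVector.vers
        ((TruncatedWittVector.teich a ^ p - TruncatedWittVector.teich a) *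
          TruncatedWittVector.teich b⁻¹ : TruncatedWittVector p m K) •
        KaehlerDifferential.D ℤ (TruncatedWittVector p m K)
          (TruncatedWittVector.vers (TruncatedWittVector.teich b)) ∈
      AddSubgroup.closure
        {ω : Ω[TruncatedWittVector p m K⁄ℤ] |
          ∃ x y : TruncatedWittVector p m K,
            ω = TruncatedWittVector.frob x • KaehlerDifferential.D ℤ _ y -
              x • KaehlerDifferential.D ℤ _ (TruncatedWittVector.vers y)} := by
  have hab : (teich a : TruncatedWittVector p m K) = teich (a * b⁻¹) * teich b := by
    rw [← teich_mul, inv_mul_cancel_right₀ hb]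
  have hbb : (teich b⁻¹ : TruncatedWittVector p m K) * teich b = 1 := by
    rw [← teich_mul, inv_mul_cancel₀ hb, teich_one]
  set D := KaehlerDifferential.D ℤ (TruncatedWittVector p m K)
  set c : TruncatedWittVector p m K := (teich a ^ p - teich a) * teich b⁻¹ with hc
  have hcancel : (teich b : TruncatedWittVector p m K) ^ p * teich b⁻¹ = teich b ^ (p - 1) := by
    rw [← pow_sub_one_mul (Fact.out : p.Prime).ne_zero, mul_assoc, mul_comm (teich b), hbb,
      mul_one]
  obtain ⟨u, hu⟩ : ∃ u : TruncatedWittVector p m K, u = teich (a * b⁻¹) := ⟨_, rfl⟩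
  have hpc : frob (vers c) • D (teich b) =
      frob u • D (frob (teich b)) -
        u • D (vers (frob (teich b))) := by
    have hD : D ((p : TruncatedWittVector p m K) * teich b) =
        (p : TruncatedWittVector p m K) • D (teich b) := by
      rw [Derivation.leibniz, Derivation.map_natCast, smul_zero, add_zero]
    rw [frob_vers, vers_frob, hD, hu, frob_teich, frob_teich, Derivation.leibniz_pow,
      ← Nat.cast_smul_eq_nsmul (TruncatedWittVector p m K),
      smul_smul, smul_smul, smul_smul, ← sub_smul, ← hcancel, hc]
    refine congrArg (fun w => w • D (teich b)) ?_
    rw [hab, ← hu]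
    linear_combination (-(p : TruncatedWittVector p m K) * u) * hbb
  have key : vers c • D (vers (teich b)) =
      (frob u • D (frob (teich b)) -
        u • D (vers (frob (teich b)))) -
      (frob (vers c) • D (teich b) - vers c • D (vers (teich b))) := by
    rw [← hpc, sub_sub_cancel]
  rw [key]
  exact AddSubgroup.sub_mem _ (AddSubgroup.subset_closure ⟨_, _, rfl⟩)
    (AddSubgroup.subset_closure ⟨_, _, rfl⟩)
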